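/- Let c be a coherent configuration on a finite set V and let E ⊆ V × V be a union of colour classes of c. Then the relation E^scc := {(u,v) : u and v lie in a common strongly connected component of E} is also a union of colour classes of c. -/

import Mathlib

/-- `c : V × V → K` is a coherent configuration with intersection numbers `q`:
(i) a colour is diagonal or off-diagonal consistently, (ii) the converse colour is
well defined, (iii) the number of `(b,d)`-triangles over a pair depends only on its colour. -/
def IsCoherentWith {V K : Type} (c : V × V → K) (q : K × K × K → ℕ) : Prop :=
  (∀ u v u' v' : V, c (u, v) = c (u', v') → (u = v ↔ u' = v')) ∧
  (∀ u v u' v' : V, c (u, v) = c (u', v') → c (v, u) = c (v', u')) ∧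
  (∀ (a b d : K) (u v : V), c (u, v) = a →
    {w : V | c (u, w) = b ∧ c (w, v) = d}.ncard = q (a, b, d))

/-- `c` is a coherent configuration. -/
def IsCoherent {V K : Type} (c : V × V → K) : Prop :=
  ∃ q : K × K × K → ℕ, IsCoherentWith c q

/-- The class of a colour `a`. -/
def colourClass {V K : Type} (c : V × V → K) (a : K) : Set (V × V) := {p | c p = a}

/-- A colour is attained if it lies in the image of `c`. -/
def Attained {V K : Type} (c : V × V → K) (a : K) : Prop := a ∈ Set.range c

/-- A colour is diagonal if its class is contained in the diagonal. -/
def IsDiagonal {V K : Type} (c : V × V → K) (a : K) : Prop :=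
  ∀ p ∈ colourClass c a, p.1 = p.2

/-- `c` refines a family `A` of binary relations: every colour class is contained in
or disjoint from each relation in `A`. -/
def RefinesFamily {V K : Type} (c : V × V → K) (A : Set (Set (V × V))) : Prop :=
  ∀ a : K, ∀ E ∈ A, colourClass c a ⊆ E ∨ Disjoint (colourClass c a) E

/-- `c'` refines `c`: every colour class of `c'` is contained in some colour class of `c`. -/
def RefinesColouring {V K K' : Type} (c' : V × V → K') (c : V × V → K) : Prop :=
  ∀ p p' : V × V, c' p = c' p' → c p = c p'

/-- `c` is a coarsest coherent configuration refining `A`. -/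
def IsCoarsest {V K : Type} (c : V × V → K) (A : Set (Set (V × V))) : Prop :=
  IsCoherent c ∧ RefinesFamily c A ∧
  ∀ (K' : Type) (c' : V × V → K'), IsCoherent c' → RefinesFamily c' A →
    RefinesColouring c' c

/-- `S` is a strongly connected component of the binary relation `R`: an
inclusion-maximal set such that any two of its members are joined by an `R`-path
of length at least `1`. -/
def IsSCC {V : Type} (R : Set (V × V)) (S : Set V) : Prop :=
  (∀ u ∈ S, ∀ v ∈ S, Relation.TransGen (fun x y => (x, y) ∈ R) u v) ∧
  ∀ T : Set V, S ⊆ T →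
    (∀ u ∈ T, ∀ v ∈ T, Relation.TransGen (fun x y => (x, y) ∈ R) u v) → T = S

/-- `E` is a union of colour classes of `c`. -/
def IsUnionOfClasses {V K : Type} (c : V × V → K) (E : Set (V × V)) : Prop :=
  ∀ p p' : V × V, c p = c p' → p ∈ E → p' ∈ E

/-- Composition of binary relations. -/
def relComp {V : Type} (R S : Set (V × V)) : Set (V × V) :=
  {p | ∃ v, (p.1, v) ∈ R ∧ (v, p.2) ∈ S}

/-- The Gaifman graph of the family `A` restricted to `U` is connected. -/
def GaifmanConnected {V : Type} (A : Set (Set (V × V))) (U : Set V) : Prop :=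
  U.Nonempty ∧ ∀ u ∈ U, ∀ v ∈ U,
    Relation.ReflTransGen
      (fun x y => x ∈ U ∧ y ∈ U ∧ ∃ E ∈ A, (x, y) ∈ E ∨ (y, x) ∈ E) u v

/-- In a coherent configuration, a triangle over a pair can be transported to any pair of the
same colour. -/
theorem IsCoherent.exists_triangle {V K : Type} [Finite V] {c : V × V → K} (h : IsCoherent c)
    {u v u' v' : V} (huv : c (u, v) = c (u', v')) (w : V) :
    ∃ w', c (u, w) = c (u', w') ∧ c (w, v) = c (w', v') := by
  obtain ⟨q, -, -, hq⟩ := h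
  have hpos : 0 < {x : V | c (u, x) = c (u, w) ∧ c (x, v) = c (w, v)}.ncard :=
    (Set.ncard_pos).2 ⟨w, rfl, rfl⟩
  rw [hq _ _ _ u v rfl, huv, ← hq _ _ _ u' v' rfl] at hpos
  obtain ⟨w', h₁, h₂⟩ := (Set.ncard_pos).1 hpos
  exact ⟨w', h₁.symm, h₂.symm⟩

/-- The transitive closure of a union of colour classes is a union of colour classes. -/
theorem IsUnionOfClasses.transGen {V K : Type} [Finite V] {c : V × V → K} (h : IsCoherent c)
    {E : Set (V × V)} (hE : IsUnionOfClasses c E) :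
    IsUnionOfClasses c {p | Relation.TransGen (fun x y => (x, y) ∈ E) p.1 p.2} := by
  rintro ⟨u, v⟩ ⟨u', v'⟩ huv (hp : Relation.TransGen _ u v)
  change Relation.TransGen _ u' v'
  induction hp generalizing v' with
  | single hub => exact .single (hE _ _ huv hub)
  | @tail b _ _ hbv ih =>
    obtain ⟨b', h₁, h₂⟩ := h.exists_triangle huv b
    exact (ih b' h₁).tail (hE _ _ h₂ hbv)

/-- Two vertices lie in a common strongly connected component if and only if each is reachable
from the other by a path of positive length. -/
theorem exists_isSCC_iff {V : Type} {R : Set (V × V)} {u v : V} :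
    (∃ S : Set V, IsSCC R S ∧ u ∈ S ∧ v ∈ S) ↔
      Relation.TransGen (fun x y => (x, y) ∈ R) u v ∧
        Relation.TransGen (fun x y => (x, y) ∈ R) v u := by
  constructor
  · rintro ⟨S, hS, hu, hv⟩
    exact ⟨hS.1 u hu v hv, hS.1 v hv u hu⟩
  · rintro ⟨huv, hvu⟩
    refine ⟨{w | Relation.TransGen (fun x y => (x, y) ∈ R) u w ∧
      Relation.TransGen (fun x y => (x, y) ∈ R) w u}, ⟨?_, ?_⟩,
      ⟨huv.trans hvu, huv.trans hvu⟩, ⟨huv, hvu⟩⟩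
    · exact fun x hx y hy => hx.2.trans hy.1
    · intro T hST hT
      have hu : u ∈ T := hST ⟨huv.trans hvu, huv.trans hvu⟩
      exact Set.Subset.antisymm (fun w hw => ⟨hT u hu w hw, hT w hw u hu⟩) hST

/-- If `E` is a union of colour classes of a coherent configuration `c`, then the
relation "lying in a common strongly connected component of `E`" is also a union
of colour classes of `c`. -/
theorem scc_relation_union_of_classes {V K : Type} [Fintype V]
    (c : V × V → K) (h : IsCoherent c)
    (E : Set (V × V)) (hE : IsUnionOfClasses c E) :
    IsUnionOfClasses c
      {p : V × V | ∃ S : Set V, IsSCC E S ∧ p.1 ∈ S ∧ p.2 ∈ S} := by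
  rintro ⟨u, v⟩ ⟨u', v'⟩ huv hp
  obtain ⟨h₁, h₂⟩ := exists_isSCC_iff.1 hp
  have hvu : c (v, u) = c (v', u') := by
    obtain ⟨q, -, hconv, -⟩ := h
    exact hconv _ _ _ _ huv
  exact exists_isSCC_iff.2 ⟨hE.transGen h _ _ huv h₁, hE.transGen h _ _ hvu h₂⟩
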